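/- Run-length locality: let s = a₁^{m₁} ⋯ a_r^{m_r} and t = a₁^{m′₁} ⋯ a_r^{m′_r} be nonempty strings with the same run symbols a₁,…,a_r (with a_i ≠ a_{i+1}) but possibly different run multiplicities, all m_i, m′_i ≥ 1, and let D = { i : m_i ≠ m′_i }. Then the token sequences F(s) and F(t) have the same length and differ exactly at the depths { min(i, r+1−i) : i ∈ D }. In particular, changing a single run length m_i rewrites exactly one content token, the one at depth min(i, r+1−i). -/

import Mathlib

/-- The alphabet `α` extended with two sentinel symbols `@` and `$`. -/
abbrev Symb (α : Type*) := α ⊕ Bool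

/-- The sentinel `@`. -/
def atSym {α : Type*} : Symb α := Sum.inr false

/-- The sentinel `$`. -/
def dollarSym {α : Type*} : Symb α := Sum.inr true

instance {α : Type*} : Inhabited (Symb α) := ⟨atSym⟩

/-- A bilateral token: a symbol string together with a split position. -/
structure Tok (β : Type*) where
  sym : List β
  split : ℕ
  deriving DecidableEq

instance {β : Type*} : Inhabited (Tok β) := ⟨⟨[], 0⟩⟩

/-- Fuel-based bilateral peeling.  On a nonempty span: if the span is a single
maximal run, emit the terminal token `(span, 0)`; otherwise remove the maximal
leading run and the maximal trailing run, emit the token whose symbol string is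
the leading run concatenated with the trailing run (split = leading-run length,
or split 0 and stop if nothing remains in the middle), and recurse on the
middle.  Any fuel `≥` the span length suffices. -/
def peelF {β : Type*} [DecidableEq β] : ℕ → List β → List (Tok β)
  | 0, _ => []
  | _ + 1, [] => []
  | fuel + 1, a :: t =>
    let w := a :: t
    let front := w.takeWhile (fun x => decide (x = a))
    let rest := w.dropWhile (fun x => decide (x = a))
    if rest.isEmpty then [⟨w, 0⟩]
    else
      let z := w.getLastD a
      let back := (w.reverse.takeWhile (fun x => decide (x = z))).reverse
      let mid := rest.take (rest.length - back.length)
      if mid.isEmpty then [⟨front ++ back, 0⟩]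
      else ⟨front ++ back, front.length⟩ :: peelF fuel mid

/-- The sentinel-wrapped form `ŝ = @ · s · $`. -/
def wrap {α : Type*} (s : List α) : List (Symb α) :=
  atSym :: s.map Sum.inl ++ [dollarSym]

/-- The Flashback decomposition `F(s)`. -/
def flashback {α : Type*} [DecidableEq α] (s : List α) : List (Tok (Symb α)) :=
  peelF (wrap s).length (wrap s)

/-- Inside-out nesting of a token sequence: the innermost symbol string is
returned verbatim, and each earlier token contributes `front ‖ inner ‖ back`. -/
def nestTok {β : Type*} : List (Tok β) → List β
  | [] => []
  | [τ] => τ.sym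
  | τ :: rest => τ.sym.take τ.split ++ nestTok rest ++ τ.sym.drop τ.split

/-- The Flashback reconstruction `F⁻¹(T)`: nest the tokens and strip the two
sentinels. -/
def reconstruct {α : Type*} (T : List (Tok (Symb α))) : List α :=
  (((nestTok T).drop 1).dropLast).filterMap Sum.getLeft?

/-- The number of maximal runs of a string. -/
def runCount {α : Type*} [DecidableEq α] : List α → ℕ
  | [] => 0
  | [_] => 1
  | a :: b :: t => (if a = b then 0 else 1) + runCount (b :: t)

/-- Length of the maximal leading run. -/
def leadRunLen {α : Type*} [DecidableEq α] : List α → ℕ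
  | [] => 0
  | a :: t => (t.takeWhile (fun x => decide (x = a))).length + 1

/-- Length of the maximal trailing run. -/
def trailRunLen {α : Type*} [DecidableEq α] (w : List α) : ℕ :=
  leadRunLen w.reverse

/-- Expansion of a run-length encoding given by 1-indexed run symbols `a i`
and run multiplicities `m i`, with `r` runs:
`a 1 ^ m 1 ++ a 2 ^ m 2 ++ ⋯ ++ a r ^ m r`. -/
def rleOfFun {α : Type*} (a : ℕ → α) (m : ℕ → ℕ) (r : ℕ) : List α :=
  (List.range r).flatMap fun i => List.replicate (m (i + 1)) (a (i + 1))

/-- The concatenation of the runs `b i ^ m i` for `k ≤ i < k + n`. -/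
def runSegment {β : Type*} (b : ℕ → β) (m : ℕ → ℕ) (k n : ℕ) : List β :=
  (List.range' k n).flatMap fun i => List.replicate (m i) (b i)

section Peeling

variable {β : Type*}

theorem runSegment_succ (b : ℕ → β) (m : ℕ → ℕ) (k n : ℕ) :
    runSegment b m k (n + 1) = List.replicate (m k) (b k) ++ runSegment b m (k + 1) n := by
  simp [runSegment, List.range'_succ]

theorem runSegment_succ_last (b : ℕ → β) (m : ℕ → ℕ) (k n : ℕ) :
    runSegment b m k (n + 1) =
      runSegment b m k n ++ List.replicate (m (k + n)) (b (k + n)) := by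
  simp [runSegment, List.range'_concat]

theorem head?_runSegment_succ (b : ℕ → β) (m : ℕ → ℕ) (k n : ℕ) (h : 1 ≤ m k) :
    (runSegment b m k (n + 1)).head? = some (b k) := by
  obtain ⟨j, hj⟩ := Nat.exists_eq_add_of_le' h
  simp [runSegment_succ, hj, List.replicate_succ]

theorem getLast?_runSegment_succ (b : ℕ → β) (m : ℕ → ℕ) (k n : ℕ) (h : 1 ≤ m (k + n)) :
    (runSegment b m k (n + 1)).getLast? = some (b (k + n)) := by
  obtain ⟨j, hj⟩ := Nat.exists_eq_add_of_le' h
  simp [runSegment_succ_last, hj, List.replicate_succ']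

theorem le_length_runSegment (b : ℕ → β) (m : ℕ → ℕ) (k n : ℕ)
    (hm : ∀ i, k ≤ i → i < k + n → 1 ≤ m i) : n ≤ (runSegment b m k n).length := by
  induction n with
  | zero => simp
  | succ n ih =>
    have h := ih fun i _ _ => hm i (by omega) (by omega)
    have := hm (k + n) (by omega) (by omega)
    rw [runSegment_succ_last, List.length_append, List.length_replicate]
    omega

variable [DecidableEq β]

theorem takeWhile_replicate_append (p : ℕ) (x : β) (l : List β) (h : l.head? ≠ some x) :
    (List.replicate p x ++ l).takeWhile (fun y => decide (y = x)) = List.replicate p x := by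
  rw [List.takeWhile_append_of_pos (by simp +contextual [List.mem_replicate])]
  cases l <;> simp_all

theorem dropWhile_replicate_append (p : ℕ) (x : β) (l : List β) (h : l.head? ≠ some x) :
    (List.replicate p x ++ l).dropWhile (fun y => decide (y = x)) = l := by
  rw [List.dropWhile_append_of_pos (by simp +contextual [List.mem_replicate])]
  cases l <;> simp_all

theorem peelF_replicate (f p : ℕ) (x : β) (hp : 1 ≤ p) :
    peelF (f + 1) (List.replicate p x) = [⟨List.replicate p x, 0⟩] := by
  obtain ⟨j, rfl⟩ := Nat.exists_eq_add_of_le' hp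
  have h := dropWhile_replicate_append (j + 1) x [] (by simp)
  simp only [List.append_nil, List.replicate_succ] at h
  simp only [List.replicate_succ, peelF, h]
  simp

theorem peelF_replicate_append (f p q : ℕ) (x z : β) (mid : List β) (hp : 1 ≤ p) (hq : 1 ≤ q)
    (hx : (mid ++ List.replicate q z).head? ≠ some x)
    (hz : (List.replicate p x ++ mid).getLast? ≠ some z) :
    peelF (f + 1) (List.replicate p x ++ (mid ++ List.replicate q z)) =
      if mid.isEmpty then [⟨List.replicate p x ++ List.replicate q z, 0⟩]
      else ⟨List.replicate p x ++ List.replicate q z, p⟩ :: peelF f mid := by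
  have hf := takeWhile_replicate_append p x _ hx
  have hd := dropWhile_replicate_append p x _ hx
  have hb := takeWhile_replicate_append q z (List.replicate p x ++ mid).reverse
    (by rwa [List.head?_reverse])
  have hrev : List.replicate q z ++ (List.replicate p x ++ mid).reverse =
      (List.replicate p x ++ (mid ++ List.replicate q z)).reverse := by simp
  rw [hrev] at hb
  have hl : (List.replicate p x ++ (mid ++ List.replicate q z)).getLastD x = z := by
    obtain ⟨j, rfl⟩ := Nat.exists_eq_add_of_le' hq
    rw [List.getLastD_eq_getLast?]
    simp [List.replicate_succ']
  obtain ⟨t, ht⟩ : ∃ t, List.replicate p x ++ (mid ++ List.replicate q z) = x :: t := by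
    obtain ⟨j, rfl⟩ := Nat.exists_eq_add_of_le' hp
    exact ⟨_, by simp [List.replicate_succ]; rfl⟩
  rw [ht] at hf hd hb hl ⊢
  have hne : (mid ++ List.replicate q z).isEmpty = false := by
    simp; omega
  simp only [peelF, hf, hd, hl, hb, hne]
  simp

theorem peelF_runSegment_one (f : ℕ) (b : ℕ → β) (m : ℕ → ℕ) (k : ℕ) (hm : 1 ≤ m k) :
    peelF (f + 1) (runSegment b m k 1) = [⟨List.replicate (m k) (b k), 0⟩] := by
  simpa [runSegment] using peelF_replicate f (m k) (b k) hm

theorem peelF_runSegment_two (f : ℕ) (b : ℕ → β) (m : ℕ → ℕ) (k : ℕ) (hm : 1 ≤ m k)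
    (hm' : 1 ≤ m (k + 1)) (hb : b k ≠ b (k + 1)) :
    peelF (f + 1) (runSegment b m k 2) =
      [⟨List.replicate (m k) (b k) ++ List.replicate (m (k + 1)) (b (k + 1)), 0⟩] := by
  have h := peelF_replicate_append f (m k) (m (k + 1)) (b k) (b (k + 1)) [] hm hm'
    (by rw [List.nil_append, List.head?_replicate]; split_ifs <;> simp [hb.symm])
    (by rw [List.append_nil, List.getLast?_replicate]; split_ifs <;> simp [hb])
  simpa [runSegment, List.range'_succ] using h

theorem peelF_runSegment_add_three (f : ℕ) (b : ℕ → β) (m : ℕ → ℕ) (k n : ℕ)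
    (hm : ∀ i, k ≤ i → i < k + (n + 3) → 1 ≤ m i)
    (hb : ∀ i, k ≤ i → i + 1 < k + (n + 3) → b i ≠ b (i + 1)) :
    peelF (f + 1) (runSegment b m k (n + 3)) =
      ⟨List.replicate (m k) (b k) ++ List.replicate (m (k + n + 2)) (b (k + n + 2)), m k⟩ ::
        peelF f (runSegment b m (k + 1) (n + 1)) := by
  have hhead := head?_runSegment_succ b m (k + 1) n (hm _ (by omega) (by omega))
  have hlast := getLast?_runSegment_succ b m (k + 1) n (hm _ (by omega) (by omega))
  have hne : (runSegment b m (k + 1) (n + 1)).isEmpty = false := by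
    cases h : runSegment b m (k + 1) (n + 1) <;> simp_all
  have e : k + 1 + (n + 1) = k + n + 2 := by omega
  have e' : k + n + 2 = (k + 1 + n) + 1 := by omega
  rw [runSegment_succ, runSegment_succ_last, e, peelF_replicate_append, hne]
  · simp
  · exact hm _ (by omega) (by omega)
  · exact hm _ (by omega) (by omega)
  · simpa [List.head?_append, hhead] using (hb k le_rfl (by omega)).symm
  · rw [e']
    simpa [List.getLast?_append, hlast] using hb (k + 1 + n) (by omega) (by omega)

theorem replicate_append_replicate_inj {x z : β} (h : x ≠ z) (p q p' q' : ℕ) :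
    List.replicate p x ++ List.replicate q z = List.replicate p' x ++ List.replicate q' z ↔
      p = p' ∧ q = q' := by
  refine ⟨fun e => ?_, by rintro ⟨rfl, rfl⟩; rfl⟩
  have hx := congrArg (List.count x) e
  have hz := congrArg (List.count z) e
  simpa [List.count_replicate, h, h.symm] using And.intro hx hz

/-- Peeling two segments with the same run symbols yields equally many tokens, and the tokens at
depth `d` differ iff one of the two runs at distance `d` from the ends changes its length. -/
theorem peelF_runSegment_locality (b : ℕ → β) (m m' : ℕ → ℕ) (n : ℕ) :
    ∀ k f f' : ℕ, n ≤ f → n ≤ f' →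
    (∀ i, k ≤ i → i < k + n → 1 ≤ m i) → (∀ i, k ≤ i → i < k + n → 1 ≤ m' i) →
    (∀ i, k ≤ i → i + 1 < k + n → b i ≠ b (i + 1)) →
    (peelF f (runSegment b m k n)).length = (n + 1) / 2 ∧
    (peelF f' (runSegment b m' k n)).length = (n + 1) / 2 ∧
    ∀ d, d < (n + 1) / 2 →
      ((peelF f (runSegment b m k n)).getD d default ≠
          (peelF f' (runSegment b m' k n)).getD d default ↔
        m (k + d) ≠ m' (k + d) ∨ m (k + n - 1 - d) ≠ m' (k + n - 1 - d)) := by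
  induction n using Nat.strong_induction_on with
  | _ n ih =>
  intro k f f' hf hf' hm hm' hb
  match n with
  | 0 => cases f <;> cases f' <;> simp [runSegment, peelF]
  | 1 =>
    obtain ⟨f, rfl⟩ := Nat.exists_eq_add_of_le' hf
    obtain ⟨f', rfl⟩ := Nat.exists_eq_add_of_le' hf'
    rw [peelF_runSegment_one _ _ _ _ (hm k le_rfl (by omega)),
      peelF_runSegment_one _ _ _ _ (hm' k le_rfl (by omega))]
    refine ⟨rfl, rfl, fun d hd => ?_⟩
    obtain rfl : d = 0 := by omega
    simp [List.replicate_inj]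
  | 2 =>
    obtain ⟨f, rfl⟩ := Nat.exists_eq_add_of_le' (show 1 ≤ f by omega)
    obtain ⟨f', rfl⟩ := Nat.exists_eq_add_of_le' (show 1 ≤ f' by omega)
    have hk := hb k le_rfl (by omega)
    rw [peelF_runSegment_two _ _ _ _ (hm k le_rfl (by omega)) (hm _ (by omega) (by omega)) hk,
      peelF_runSegment_two _ _ _ _ (hm' k le_rfl (by omega)) (hm' _ (by omega) (by omega)) hk]
    refine ⟨rfl, rfl, fun d hd => ?_⟩
    obtain rfl : d = 0 := by omega
    simp [replicate_append_replicate_inj hk]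
    tauto
  | n + 3 =>
    obtain ⟨f, rfl⟩ := Nat.exists_eq_add_of_le' (show 1 ≤ f by omega)
    obtain ⟨f', rfl⟩ := Nat.exists_eq_add_of_le' (show 1 ≤ f' by omega)
    obtain ⟨h₁, h₂, h₃⟩ := ih (n + 1) (by omega) (k + 1) f f' (by omega) (by omega)
      (fun i _ _ => hm i (by omega) (by omega)) (fun i _ _ => hm' i (by omega) (by omega))
      (fun i _ _ => hb i (by omega) (by omega))
    rw [peelF_runSegment_add_three _ _ _ _ _ hm hb, peelF_runSegment_add_three _ _ _ _ _ hm' hb]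
    refine ⟨by rw [List.length_cons, h₁]; omega, by rw [List.length_cons, h₂]; omega, ?_⟩
    rintro (_ | d) hd
    · have e : k + (n + 3) - 1 - 0 = k + n + 2 := by omega
      simp only [List.getD_cons_zero, ne_eq, Tok.mk.injEq, e, Nat.add_zero]
      rw [← not_and_or, not_iff_not]
      constructor
      · rintro ⟨h, hk⟩
        refine ⟨hk, ?_⟩
        have := congrArg List.length h
        simp at this
        omega
      · rintro ⟨h, h'⟩
        rw [h, h']
        exact ⟨rfl, rfl⟩
    · have e : k + (n + 3) - 1 - (d + 1) = k + 1 + (n + 1) - 1 - d := by omega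
      have e' : k + (d + 1) = k + 1 + d := by omega
      rw [List.getD_cons_succ, List.getD_cons_succ, e, e']
      exact h₃ d (by omega)

end Peeling

/-- The run symbols of the sentinel-wrapped string, where run `0` is `@` and run `r + 1` is `$`. -/
def wrapSymb {α : Type*} (a : ℕ → α) (r i : ℕ) : Symb α :=
  if i = 0 then atSym else if i = r + 1 then dollarSym else Sum.inl (a i)

/-- The run multiplicities of the sentinel-wrapped string. -/
def wrapMult (m : ℕ → ℕ) (r i : ℕ) : ℕ :=
  if i = 0 ∨ i = r + 1 then 1 else m i

theorem wrap_rleOfFun {α : Type*} (a : ℕ → α) (m : ℕ → ℕ) (r : ℕ) :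
    wrap (rleOfFun a m r) = runSegment (wrapSymb a r) (wrapMult m r) 0 (r + 2) := by
  have h : runSegment (wrapSymb a r) (wrapMult m r) 1 r = (rleOfFun a m r).map Sum.inl := by
    rw [runSegment, rleOfFun, List.map_flatMap, List.range'_eq_map_range, List.flatMap_map]
    refine List.flatMap_congr fun i hi => ?_
    have hi := List.mem_range.mp hi
    rw [wrapSymb, wrapMult, if_neg (by omega), if_neg (by omega), if_neg (by omega),
      List.map_replicate, Nat.add_comm]
  rw [runSegment_succ, runSegment_succ_last, h]
  simp [wrap, wrapSymb, wrapMult, Nat.add_comm]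

theorem one_le_wrapMult (m : ℕ → ℕ) (r : ℕ) (hm : ∀ i, 1 ≤ i → i ≤ r → 1 ≤ m i) (i : ℕ)
    (hi : i < r + 2) : 1 ≤ wrapMult m r i := by
  rw [wrapMult]
  split_ifs
  · exact le_rfl
  · exact hm i (by omega) (by omega)

theorem wrapSymb_ne_succ {α : Type*} (a : ℕ → α) (r : ℕ)
    (ha : ∀ i, 1 ≤ i → i < r → a i ≠ a (i + 1)) (i : ℕ) (hi : i < r + 1) :
    wrapSymb a r i ≠ wrapSymb a r (i + 1) := by
  have := ha i
  unfold wrapSymb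
  split_ifs <;> simp_all [atSym, dollarSym] ; grind

theorem wrapMult_ne_iff (m m' : ℕ → ℕ) (r i : ℕ) (hi : i < r + 2) :
    wrapMult m r i ≠ wrapMult m' r i ↔ 1 ≤ i ∧ i ≤ r ∧ m i ≠ m' i := by
  unfold wrapMult
  split_ifs <;> grind

/-- **Run-length locality.**  Let `s = a₁^{m₁} ⋯ a_r^{m_r}` and
`t = a₁^{m′₁} ⋯ a_r^{m′_r}` be nonempty strings with the same run symbols but
possibly different run multiplicities, and let `D = {i : m_i ≠ m′_i}`.  Then
`F(s)` and `F(t)` have the same length and differ exactly at the depths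
`{min(i, r+1-i) : i ∈ D}`. -/
theorem flashback_run_length_locality {α : Type*} [DecidableEq α]
    (a : ℕ → α) (m m' : ℕ → ℕ) (r : ℕ) (hr : 1 ≤ r)
    (hm : ∀ i, 1 ≤ i → i ≤ r → 1 ≤ m i)
    (hm' : ∀ i, 1 ≤ i → i ≤ r → 1 ≤ m' i)
    (ha : ∀ i, 1 ≤ i → i < r → a i ≠ a (i + 1))
    (s t : List α) (hs : s = rleOfFun a m r) (ht : t = rleOfFun a m' r) :
    (flashback s).length = (flashback t).length ∧
    ∀ d, d < (flashback s).length →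
      ((flashback s).getD d default ≠ (flashback t).getD d default ↔
        ∃ i, 1 ≤ i ∧ i ≤ r ∧ m i ≠ m' i ∧ d = min i (r + 1 - i)) := by
  subst hs ht
  have hM := one_le_wrapMult m r hm
  have hM' := one_le_wrapMult m' r hm'
  obtain ⟨h₁, h₂, h₃⟩ := peelF_runSegment_locality (wrapSymb a r) (wrapMult m r) (wrapMult m' r)
    (r + 2) 0 _ _
    (le_length_runSegment (wrapSymb a r) _ 0 _ fun i _ _ => hM i (by omega))
    (le_length_runSegment (wrapSymb a r) _ 0 _ fun i _ _ => hM' i (by omega))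
    (fun i _ _ => hM i (by omega)) (fun i _ _ => hM' i (by omega))
    (fun i _ _ => wrapSymb_ne_succ a r ha i (by omega))
  simp only [flashback, wrap_rleOfFun]
  refine ⟨h₁.trans h₂.symm, fun d hd => ?_⟩
  rw [h₁] at hd
  rw [h₃ d hd, wrapMult_ne_iff _ _ _ _ (by omega), wrapMult_ne_iff _ _ _ _ (by omega)]
  constructor
  · rintro (⟨h, h', hne⟩ | ⟨h, h', hne⟩)
    · exact ⟨_, h, h', hne, by omega⟩
    · exact ⟨_, h, h', hne, by omega⟩
  · rintro ⟨i, h, h', hne, hd'⟩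
    rcases Nat.le_total i (r + 1 - i) with hi | hi
    · obtain rfl : 0 + d = i := by omega
      exact Or.inl ⟨h, h', hne⟩
    · obtain rfl : 0 + (r + 2) - 1 - d = i := by omega
      exact Or.inr ⟨h, h', hne⟩
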